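/- arXiv:2204.00032 — 2 statements merged into one kernel-verified Lean document; each statement's English description precedes it below -/
import Mathlib

section
/- Let E be a real inner product space, let D be a labeled dataset containing (x₀, false) and (x₁, true) with ‖x₁ − x₀‖ = 2m for some m > 0, and let (w, b) linearly separate D with margin at least m. Then the distance from x₀ to the hyperplane {z : ⟪w, z⟫ + b = 0} equals m and the distance from x₁ to this hyperplane equals m; that is, both x₀ and x₁ attain the minimum distance and are support vectors of this separator. -/
open RealInnerProductSpace

variable {E : Type*} [NormedAddCommGroup E] [InnerProductSpace ℝ E]

/-- A pair `(w, b)` with `w ≠ 0` linearly separates the labeled dataset `D` if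
`⟪w, x⟫ + b > 0` for every positive point and `⟪w, x⟫ + b < 0` for every negative point. -/
def Separates (w : E) (b : ℝ) (D : Finset (E × Bool)) : Prop :=
  (∀ p ∈ D, p.2 = true → 0 < ⟪w, p.1⟫ + b) ∧
  (∀ p ∈ D, p.2 = false → ⟪w, p.1⟫ + b < 0)

/-- The margin of the pair `(w, b)` on a (nonempty) dataset `D`: the minimum over
`(x, c) ∈ D` of the distance `|⟪w, x⟫ + b| / ‖w‖` from `x` to the hyperplane. -/
noncomputable def margin (w : E) (b : ℝ) (D : Finset (E × Bool)) : ℝ :=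
  sInf ((fun p : E × Bool => |⟪w, p.1⟫ + b| / ‖w‖) '' (D : Set (E × Bool)))

/-- The margin is at most the distance from any data point to the hyperplane. -/
theorem margin_le_of_mem (w : E) (b : ℝ) {D : Finset (E × Bool)} {p : E × Bool} (hp : p ∈ D) :
    margin w b D ≤ |⟪w, p.1⟫ + b| / ‖w‖ :=
  csInf_le ⟨0, by rintro _ ⟨q, -, rfl⟩; positivity⟩ ⟨p, hp, rfl⟩

/-- If `D` contains `(x₀, false)` and `(x₁, true)` with `‖x₁ - x₀‖ = 2m`, `m > 0`, and
`(w, b)` separates `D` with margin at least `m`, then both `x₀` and `x₁` are at distance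
exactly `m` from the hyperplane, i.e. both are support vectors of this separator. -/
theorem extremal_points_are_support_vectors
    (D : Finset (E × Bool)) (x₀ x₁ : E) (m : ℝ) (hm : 0 < m)
    (h₀ : (x₀, false) ∈ D) (h₁ : (x₁, true) ∈ D)
    (hdist : ‖x₁ - x₀‖ = 2 * m)
    (w : E) (b : ℝ) (hw : w ≠ 0) (hsep : Separates w b D)
    (hmargin : m ≤ margin w b D) :
    |⟪w, x₀⟫ + b| / ‖w‖ = m ∧ |⟪w, x₁⟫ + b| / ‖w‖ = m := by
  have hw' : 0 < ‖w‖ := norm_pos_iff.mpr hw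
  have d₀ := hmargin.trans (margin_le_of_mem w b h₀)
  have d₁ := hmargin.trans (margin_le_of_mem w b h₁)
  have neg : ⟪w, x₀⟫ + b < 0 := hsep.2 _ h₀ rfl
  have pos : 0 < ⟪w, x₁⟫ + b := hsep.1 _ h₁ rfl
  have cauchy := real_inner_le_norm w (x₁ - x₀)
  rw [hdist, inner_sub_right] at cauchy
  simp only [abs_of_neg neg, abs_of_pos pos, le_div_iff₀ hw', div_eq_iff hw'.ne'] at d₀ d₁ ⊢
  constructor <;> linarith
end

section
/- Let E be a real inner product space, let w ∈ E with w ≠ 0, let δ > 0, and let D be a labeled dataset with (x_t, false) ∈ D such that every (x, true) ∈ D satisfies ⟪w, x − x_t⟫ ≥ δ‖w‖ and every (x, false) ∈ D with (x, false) ≠ (x_t, false) satisfies ⟪w, x − x_t⟫ ≤ −δ‖w‖. Set x_p := x_t + (δ / (2‖w‖)) • w. Then the supremum, over all pairs (w', b') linearly separating D ∪ {(x_p, true)}, of the margin of (w', b') equals δ/4, while the supremum of margins over all pairs linearly separating (D \ {(x_t, false)}) ∪ {(x_p, true)} is at least δ/2. In particular, the optimal margin of the poisoned dataset is strictly larger when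 the target point (x_t, false) is absent than when it is present, so the two cases are distinguishable from the maximum margin alone. -/
open RealInnerProductSpace

variable {E : Type*} [NormedAddCommGroup E] [InnerProductSpace ℝ E] [DecidableEq E]

/-- The optimal (maximum) margin of a dataset: the supremum, over all pairs `(w, b)`
linearly separating `D`, of the margin of `(w, b)` on `D` (taken in `EReal` so that it is
well-defined even when the set of achievable margins is empty or unbounded). -/
noncomputable def optMargin (D : Finset (E × Bool)) : EReal :=
  sSup {m : EReal | ∃ w : E, ∃ b : ℝ, w ≠ 0 ∧ Separates w b D ∧ (margin w b D : EReal) = m}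

theorem margin_le {F : Type*} [NormedAddCommGroup F] [InnerProductSpace ℝ F]
    (w : F) (b : ℝ) {D : Finset (F × Bool)} {p : F × Bool} (hp : p ∈ D) :
    margin w b D ≤ |⟪w, p.1⟫ + b| / ‖w‖ :=
  csInf_le ⟨0, by rintro _ ⟨q, -, rfl⟩; positivity⟩ ⟨p, hp, rfl⟩

/-- A hyperplane whose signed distance to every point of `D` has the right sign and is at least
`r > 0` in absolute value witnesses that the optimal margin is at least `r`. -/
theorem le_optMargin {F : Type*} [NormedAddCommGroup F] [InnerProductSpace ℝ F]
    {w : F} (hw : w ≠ 0) (b : ℝ) {D : Finset (F × Bool)} (hD : D.Nonempty) {r : ℝ} (hr : 0 < r)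
    (hpos : ∀ p ∈ D, p.2 = true → r * ‖w‖ ≤ ⟪w, p.1⟫ + b)
    (hneg : ∀ p ∈ D, p.2 = false → ⟪w, p.1⟫ + b ≤ -(r * ‖w‖)) :
    (r : EReal) ≤ optMargin D := by
  have hw' : 0 < ‖w‖ := norm_pos_iff.2 hw
  have hrw : 0 < r * ‖w‖ := mul_pos hr hw'
  have hle : r ≤ margin w b D := by
    refine le_csInf (Set.Nonempty.image _ hD) ?_
    rintro _ ⟨p, hp, rfl⟩
    rw [le_div_iff₀ hw', le_abs]
    cases hc : p.2 with
    | true => exact Or.inl (hpos p hp hc)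
    | false => exact Or.inr (le_neg_of_le_neg (hneg p hp hc))
  refine (EReal.coe_le_coe_iff.2 hle).trans (le_sSup ⟨w, b, hw, ⟨?_, ?_⟩, rfl⟩)
  · exact fun p hp hc => hrw.trans_le (hpos p hp hc)
  · exact fun p hp hc => (hneg p hp hc).trans_lt (neg_neg_of_pos hrw)

/-- The optimal margin is at most half the distance between any two oppositely labeled points. -/
theorem optMargin_le_half_norm_sub {F : Type*} [NormedAddCommGroup F] [InnerProductSpace ℝ F]
    {D : Finset (F × Bool)} {x y : F} (hx : (x, true) ∈ D) (hy : (y, false) ∈ D) :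
    optMargin D ≤ ((‖x - y‖ / 2 : ℝ) : EReal) := by
  refine sSup_le ?_
  rintro _ ⟨w, b, hw, ⟨hp, hn⟩, rfl⟩
  rw [EReal.coe_le_coe_iff]
  have hw' : 0 < ‖w‖ := norm_pos_iff.2 hw
  have h₁ := margin_le w b hx
  have h₂ := margin_le w b hy
  rw [abs_of_pos (hp _ hx rfl), le_div_iff₀ hw'] at h₁
  rw [abs_of_neg (hn _ hy rfl), le_div_iff₀ hw'] at h₂
  have h₃ := real_inner_le_norm w (x - y)
  rw [inner_sub_right] at h₃
  refine le_of_mul_le_mul_right ?_ hw'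
  dsimp only at h₁ h₂
  linarith

/-- With the poison `x_p = x_t + (δ/(2‖w‖)) w`, the optimal margin of the poisoned dataset
`D ∪ {(x_p, true)}` is exactly `δ/4`, while the optimal margin of
`(D \ {(x_t, false)}) ∪ {(x_p, true)}` (target absent) is at least `δ/2`; in particular the
optimal margin is strictly larger when the target is absent, so membership of the target is
distinguishable from the maximum margin alone. -/
theorem optimal_margins_distinguish_membership
    (w : E) (hw : w ≠ 0) (δ : ℝ) (hδ : 0 < δ)
    (D : Finset (E × Bool)) (xt : E) (hmem : (xt, false) ∈ D)
    (hpos : ∀ p ∈ D, p.2 = true → δ * ‖w‖ ≤ ⟪w, p.1 - xt⟫)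
    (hneg : ∀ p ∈ D, p.2 = false → p ≠ (xt, false) → ⟪w, p.1 - xt⟫ ≤ -(δ * ‖w‖))
    (xp : E) (hxp : xp = xt + (δ / (2 * ‖w‖)) • w) :
    optMargin (D ∪ {(xp, true)}) = ((δ / 4 : ℝ) : EReal) ∧
    ((δ / 2 : ℝ) : EReal) ≤ optMargin (D.erase (xt, false) ∪ {(xp, true)}) ∧
    optMargin (D ∪ {(xp, true)}) < optMargin (D.erase (xt, false) ∪ {(xp, true)}) := by
  have hw' : 0 < ‖w‖ := norm_pos_iff.2 hw
  have hδw : 0 < δ * ‖w‖ := mul_pos hδ hw'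
  have hxp_inner : ⟪w, xp⟫ = ⟪w, xt⟫ + δ * ‖w‖ / 2 := by
    rw [hxp, inner_add_right, inner_smul_right, real_inner_self_eq_norm_sq]
    field_simp
  have hnorm : ‖xp - xt‖ = δ / 2 := by
    rw [hxp, add_sub_cancel_left, norm_smul, Real.norm_of_nonneg (by positivity)]
    field_simp
  simp only [inner_sub_right] at hpos hneg
  have hpresent : optMargin (D ∪ {(xp, true)}) = ((δ / 4 : ℝ) : EReal) := by
    apply le_antisymm
    · have h := optMargin_le_half_norm_sub (D := D ∪ {(xp, true)}) (x := xp) (y := xt)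
        (by simp) (by simp [hmem])
      rwa [hnorm, show δ / 2 / 2 = δ / 4 by ring] at h
    · refine le_optMargin hw (-⟪w, xt⟫ - δ * ‖w‖ / 4) ⟨(xp, true), by simp⟩ (by positivity) ?_ ?_
      · intro p hp hc
        rw [Finset.mem_union, Finset.mem_singleton] at hp
        rcases hp with hp | rfl
        · linarith [hpos p hp hc]
        · dsimp only
          linarith
      · intro p hp hc
        rw [Finset.mem_union, Finset.mem_singleton] at hp
        rcases hp with hp | rfl
        · by_cases h : p = (xt, false)
          · subst h
            dsimp only
            linarith
          · linarith [hneg p hp hc h]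
        · simp at hc
  have habsent : ((δ / 2 : ℝ) : EReal) ≤ optMargin (D.erase (xt, false) ∪ {(xp, true)}) := by
    refine le_optMargin hw (-⟪w, xt⟫) ⟨(xp, true), by simp⟩ (by positivity) ?_ ?_
    · intro p hp hc
      rw [Finset.mem_union, Finset.mem_singleton] at hp
      rcases hp with hp | rfl
      · linarith [hpos p (Finset.mem_of_mem_erase hp) hc]
      · dsimp only
        linarith
    · intro p hp hc
      rw [Finset.mem_union, Finset.mem_singleton] at hp
      rcases hp with hp | rfl
      · linarith [hneg p (Finset.mem_of_mem_erase hp) hc (Finset.ne_of_mem_erase hp)]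
      · simp at hc
  refine ⟨hpresent, habsent, ?_⟩
  rw [hpresent]
  exact (EReal.coe_lt_coe_iff.2 (by linarith)).trans_le habsent
end
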